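/- arXiv:2302.13630 — 2 statements merged into one kernel-verified Lean document; each statement's English description precedes it below -/
import Mathlib

section
/- A continuous Banach bundle s : E → M over a locally compact Hausdorff space M is locally trivial if and only if all fibers E_m are finite-dimensional and the dimension function m ↦ dim E_m is locally constant on M. -/
open Topology Filter

universe u v

variable {M : Type u} [TopologicalSpace M]

/-- A continuous Banach bundle over `M` (total space `Σ m, F m` with a given topology). -/
structure IsContinuousBanachBundle (F : M → Type v) [∀ m, NormedAddCommGroup (F m)]
    [∀ m, NormedSpace ℂ (F m)] [∀ m, CompleteSpace (F m)]
    [TopologicalSpace (Σ m, F m)] : Prop where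
  continuous_proj : Continuous (Sigma.fst : (Σ m, F m) → M)
  isOpenMap_proj : IsOpenMap (Sigma.fst : (Σ m, F m) → M)
  continuous_add : @Continuous (Σ m, F m × F m) (Σ m, F m)
    (TopologicalSpace.induced
      (fun vw : Σ m, F m × F m =>
        ((⟨vw.1, vw.2.1⟩ : Σ m, F m), (⟨vw.1, vw.2.2⟩ : Σ m, F m)))
      inferInstance)
    inferInstance
    (fun vw => ⟨vw.1, vw.2.1 + vw.2.2⟩)
  continuous_smul : Continuous
    (fun cv : ℂ × (Σ m, F m) => (⟨cv.2.1, cv.1 • cv.2.2⟩ : Σ m, F m))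
  continuous_norm : Continuous (fun v : Σ m, F m => ‖v.2‖)
  nhds_basis_zero : ∀ (m : M) (V : Set (Σ m', F m')),
    V ∈ 𝓝 (⟨m, 0⟩ : Σ m', F m') →
      ∃ O ∈ 𝓝 m, ∃ ε > (0 : ℝ), {v : Σ m', F m' | v.1 ∈ O ∧ ‖v.2‖ < ε} ⊆ V

/-- Local triviality of a continuous Banach bundle: every point has a compact
neighborhood `C` over which the bundle is homeomorphic to `C × ℂ^d` by a fiber-preserving
fiberwise-linear homeomorphism with uniformly equivalent norms. -/
def IsLocallyTrivialBanachBundle (F : M → Type v) [∀ m, NormedAddCommGroup (F m)]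
    [∀ m, NormedSpace ℂ (F m)] [TopologicalSpace (Σ m, F m)] : Prop :=
  ∀ m₀ : M, ∃ C : Set M, IsCompact C ∧ C ∈ 𝓝 m₀ ∧ ∃ (d : ℕ)
    (Φ : {v : Σ m, F m // v.1 ∈ C} ≃ₜ C × EuclideanSpace ℂ (Fin d)),
      (∀ v, ((Φ v).1 : M) = v.1.1) ∧
      (∀ (m : M) (hm : m ∈ C) (x y : F m),
        (Φ ⟨⟨m, x + y⟩, hm⟩).2 = (Φ ⟨⟨m, x⟩, hm⟩).2 + (Φ ⟨⟨m, y⟩, hm⟩).2) ∧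
      (∀ (m : M) (hm : m ∈ C) (c : ℂ) (x : F m),
        (Φ ⟨⟨m, c • x⟩, hm⟩).2 = c • (Φ ⟨⟨m, x⟩, hm⟩).2) ∧
      ∃ c₁ c₂ : ℝ, 0 < c₁ ∧ 0 < c₂ ∧
        ∀ v : {v : Σ m, F m // v.1 ∈ C},
          c₁ * ‖v.1.2‖ ≤ ‖(Φ v).2‖ ∧ ‖(Φ v).2‖ ≤ c₂ * ‖v.1.2‖

namespace IsContinuousBanachBundle

section

variable {F : M → Type v} [∀ m, NormedAddCommGroup (F m)] [∀ m, NormedSpace ℂ (F m)]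
  [∀ m, CompleteSpace (F m)] [TopologicalSpace (Σ m, F m)]

theorem exists_nhds_add (hB : IsContinuousBanachBundle F) {m : M} {x y : F m}
    {W : Set (Σ m, F m)} (hW : W ∈ 𝓝 (⟨m, x + y⟩ : Σ m, F m)) :
    ∃ V₁ ∈ 𝓝 (⟨m, x⟩ : Σ m, F m), ∃ V₂ ∈ 𝓝 (⟨m, y⟩ : Σ m, F m),
      ∀ (m' : M) (a b : F m'), (⟨m', a⟩ : Σ m, F m) ∈ V₁ → (⟨m', b⟩ : Σ m, F m) ∈ V₂ →
        (⟨m', a + b⟩ : Σ m, F m) ∈ W := by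
  let : TopologicalSpace (Σ m, F m × F m) := TopologicalSpace.induced
      (fun vw : Σ m, F m × F m =>
        ((⟨vw.1, vw.2.1⟩ : Σ m, F m), (⟨vw.1, vw.2.2⟩ : Σ m, F m))) inferInstance
  have h := (hB.continuous_add.tendsto ⟨m, x, y⟩) hW
  rw [nhds_induced, Filter.mem_map, Filter.mem_comap] at h
  obtain ⟨t, ht, hts⟩ := h
  rw [nhds_prod_eq, Filter.mem_prod_iff] at ht
  obtain ⟨V₁, h₁, V₂, h₂, h₁₂⟩ := ht
  exact ⟨V₁, h₁, V₂, h₂, fun m' a b ha hb => hts (a := ⟨m', a, b⟩) (h₁₂ ⟨ha, hb⟩)⟩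

theorem exists_nhds_smul (hB : IsContinuousBanachBundle F) {m : M} {c : ℂ} {x : F m}
    {W : Set (Σ m, F m)} (hW : W ∈ 𝓝 (⟨m, c • x⟩ : Σ m, F m)) :
    ∃ N ∈ 𝓝 c, ∃ V ∈ 𝓝 (⟨m, x⟩ : Σ m, F m),
      ∀ (c' : ℂ) (m' : M) (a : F m'), c' ∈ N → (⟨m', a⟩ : Σ m, F m) ∈ V →
        (⟨m', c' • a⟩ : Σ m, F m) ∈ W := by
  have h := (hB.continuous_smul.tendsto (c, ⟨m, x⟩)) hW
  rw [Filter.mem_map, nhds_prod_eq, Filter.mem_prod_iff] at h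
  obtain ⟨N, hN, V, hV, h⟩ := h
  exact ⟨N, hN, V, hV, fun c' m' a hc ha => h (a := (c', ⟨m', a⟩)) ⟨hc, ha⟩⟩

theorem exists_nhds_norm_sub_lt (hB : IsContinuousBanachBundle F) {m : M} {x y : F m} {r : ℝ}
    (hr : ‖x - y‖ < r) :
    ∃ V₁ ∈ 𝓝 (⟨m, x⟩ : Σ m, F m), ∃ V₂ ∈ 𝓝 (⟨m, y⟩ : Σ m, F m),
      ∀ (m' : M) (a b : F m'), (⟨m', a⟩ : Σ m, F m) ∈ V₁ → (⟨m', b⟩ : Σ m, F m) ∈ V₂ →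
        ‖a - b‖ < r := by
  have hW : {v : Σ m, F m | ‖v.2‖ < r} ∈ 𝓝 (⟨m, x + (-1 : ℂ) • y⟩ : Σ m, F m) :=
    (isOpen_lt hB.continuous_norm continuous_const).mem_nhds
      (by simpa [← sub_eq_add_neg] using hr)
  obtain ⟨V₁, h₁, V₂, h₂, h⟩ := hB.exists_nhds_add hW
  obtain ⟨N, hN, V₃, h₃, h'⟩ := hB.exists_nhds_smul h₂
  refine ⟨V₁, h₁, V₃, h₃, fun m' a b ha hb => ?_⟩
  simpa [← sub_eq_add_neg] using h m' a _ ha (h' (-1) m' b (mem_of_mem_nhds hN) hb)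

theorem eventually_exists_mem (hB : IsContinuousBanachBundle F) {m : M} {x : F m}
    {V : Set (Σ m, F m)} (hV : V ∈ 𝓝 (⟨m, x⟩ : Σ m, F m)) :
    ∀ᶠ m' in 𝓝 m, ∃ y : F m', (⟨m', y⟩ : Σ m, F m) ∈ V := by
  filter_upwards [hB.isOpenMap_proj.image_mem_nhds hV]
  rintro _ ⟨⟨m', y⟩, hy, rfl⟩
  exact ⟨y, hy⟩

end

end IsContinuousBanachBundle

/-- A section `f` is continuous at `m` up to the tolerance `τ`: near `m`, its values are
`τ`-close to every given neighborhood of `f m` in the total space. -/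
def ApproxContinuousAt {F : M → Type v} [∀ m, NormedAddCommGroup (F m)]
    [TopologicalSpace (Σ m, F m)] (f : ∀ m, F m) (τ : M → ℝ) (m : M) : Prop :=
  ∀ V ∈ 𝓝 (⟨m, f m⟩ : Σ m, F m),
    ∀ᶠ m' in 𝓝 m, ∃ y : F m', (⟨m', y⟩ : Σ m, F m) ∈ V ∧ ‖f m' - y‖ ≤ τ m'

theorem ApproxContinuousAt.mono {F : M → Type v} [∀ m, NormedAddCommGroup (F m)]
    [TopologicalSpace (Σ m, F m)] {f : ∀ m, F m} {τ σ : M → ℝ} {m : M}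
    (hf : ApproxContinuousAt f τ m) (h : ∀ᶠ m' in 𝓝 m, τ m' ≤ σ m') :
    ApproxContinuousAt f σ m := by
  intro V hV
  filter_upwards [hf V hV, h] with m' ⟨y, hy, hle⟩ hm'
  exact ⟨y, hy, hle.trans hm'⟩

theorem ApproxContinuousAt.congr {F : M → Type v} [∀ m, NormedAddCommGroup (F m)]
    [TopologicalSpace (Σ m, F m)] {f g : ∀ m, F m} {τ : M → ℝ} {m : M}
    (hf : ApproxContinuousAt f τ m) (h : ∀ᶠ m' in 𝓝 m, f m' = g m') :
    ApproxContinuousAt g τ m := by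
  intro V hV
  rw [← h.self_of_nhds] at hV
  filter_upwards [hf V hV, h] with m' hy hm'
  rwa [← hm']

theorem ContinuousAt.approxContinuousAt {F : M → Type v} [∀ m, NormedAddCommGroup (F m)]
    [TopologicalSpace (Σ m, F m)] {f : ∀ m, F m} {m : M}
    (hf : ContinuousAt (fun m => (⟨m, f m⟩ : Σ m, F m)) m) : ApproxContinuousAt f 0 m := by
  intro V hV
  filter_upwards [hf.eventually_mem hV] with m' hm'
  exact ⟨f m', hm', by simp⟩

/-- The linear combinations of the values at `m` of a family of sections. -/
noncomputable def sectionCombination {N : Type*} {F : N → Type*} [∀ m, AddCommGroup (F m)]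
    [∀ m, Module ℂ (F m)] {d : ℕ} (e : Fin d → ∀ m, F m) (m : N) :
    EuclideanSpace ℂ (Fin d) →ₗ[ℂ] F m :=
  Fintype.linearCombination ℂ (fun i => e i m) ∘ₗ (WithLp.linearEquiv 2 ℂ (Fin d → ℂ)).toLinearMap

theorem sectionCombination_apply {N : Type*} {F : N → Type*} [∀ m, AddCommGroup (F m)]
    [∀ m, Module ℂ (F m)] {d : ℕ} (e : Fin d → ∀ m, F m) (m : N)
    (c : EuclideanSpace ℂ (Fin d)) : sectionCombination e m c = ∑ i, c i • e i m := rfl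

namespace IsContinuousBanachBundle

section

variable {F : M → Type v} [∀ m, NormedAddCommGroup (F m)] [∀ m, NormedSpace ℂ (F m)]
  [∀ m, CompleteSpace (F m)] [TopologicalSpace (Σ m, F m)]

theorem continuousAt_of_approxContinuousAt (hB : IsContinuousBanachBundle F) {f : ∀ m, F m}
    {m : M} (hf : ∀ ε > (0 : ℝ), ApproxContinuousAt f (fun _ => ε) m) :
    ContinuousAt (fun m => (⟨m, f m⟩ : Σ m, F m)) m := by
  refine Filter.tendsto_def.2 fun W hW => ?_
  have hW' : W ∈ 𝓝 (⟨m, f m + 0⟩ : Σ m, F m) := by simpa using hW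
  obtain ⟨V₁, h₁, V₂, h₂, h⟩ := hB.exists_nhds_add hW'
  obtain ⟨O, hO, ε, hε, hOε⟩ := hB.nhds_basis_zero m V₂ h₂
  filter_upwards [hf (ε / 2) (by positivity) V₁ h₁, hO] with m' ⟨y, hy, hle⟩ hm'
  have := h m' y (f m' - y) hy (hOε ⟨hm', hle.trans_lt (by linarith)⟩)
  simpa using this

theorem continuous_zero_section (hB : IsContinuousBanachBundle F) :
    Continuous (fun m => (⟨m, 0⟩ : Σ m, F m)) := by
  refine continuous_iff_continuousAt.2 fun m =>
    Filter.tendsto_def.2 fun V hV => ?_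
  obtain ⟨O, hO, ε, hε, h⟩ := hB.nhds_basis_zero m V hV
  filter_upwards [hO] with m' hm'
  exact h ⟨hm', by simpa using hε⟩

theorem approxContinuousAt_zero (hB : IsContinuousBanachBundle F) (m : M) :
    ApproxContinuousAt (0 : ∀ m, F m) 0 m :=
  hB.continuous_zero_section.continuousAt.approxContinuousAt

theorem approxContinuousAt_add (hB : IsContinuousBanachBundle F) {f g : ∀ m, F m}
    {τ σ : M → ℝ} {m : M} (hf : ApproxContinuousAt f τ m) (hg : ApproxContinuousAt g σ m) :
    ApproxContinuousAt (f + g) (τ + σ) m := by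
  intro W hW
  obtain ⟨V₁, h₁, V₂, h₂, h⟩ := hB.exists_nhds_add (x := f m) (y := g m) hW
  filter_upwards [hf V₁ h₁, hg V₂ h₂] with m' ⟨y, hy, hyle⟩ ⟨z, hz, hzle⟩
  refine ⟨y + z, h m' y z hy hz, ?_⟩
  rw [Pi.add_apply, Pi.add_apply, add_sub_add_comm]
  exact (norm_add_le _ _).trans (add_le_add hyle hzle)

theorem approxContinuousAt_smul (hB : IsContinuousBanachBundle F) {f : ∀ m, F m}
    {τ : M → ℝ} {m : M} {ρ : M → ℂ} (hρ : ContinuousAt ρ m) (hf : ApproxContinuousAt f τ m) :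
    ApproxContinuousAt (fun m => ρ m • f m) (fun m => ‖ρ m‖ * τ m) m := by
  intro W hW
  obtain ⟨N, hN, V, hV, h⟩ := hB.exists_nhds_smul hW
  filter_upwards [hf V hV, hρ hN] with m' ⟨y, hy, hyle⟩ hm'
  refine ⟨ρ m' • y, h _ m' y hm' hy, ?_⟩
  rw [← smul_sub, norm_smul]
  gcongr

theorem approxContinuousAt_sum (hB : IsContinuousBanachBundle F) {ι : Type*} (s : Finset ι)
    {f : ι → ∀ m, F m} {τ : ι → M → ℝ} {m : M}
    (hf : ∀ i ∈ s, ApproxContinuousAt (f i) (τ i) m) :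
    ApproxContinuousAt (∑ i ∈ s, f i) (∑ i ∈ s, τ i) m := by
  classical
  induction s using Finset.induction_on with
  | empty => simpa using hB.approxContinuousAt_zero m
  | insert i s hi ih =>
    rw [Finset.sum_insert hi, Finset.sum_insert hi]
    exact hB.approxContinuousAt_add (hf i (by simp)) (ih fun j hj => hf j (by simp [hj]))

theorem approxContinuousAt_of_norm_sub_le (hB : IsContinuousBanachBundle F) {f g : ∀ m, F m}
    {a δ η : ℝ} {m : M} (hf : ApproxContinuousAt f (fun _ => a) m)
    (h : ∀ᶠ m' in 𝓝 m, ‖f m' - g m'‖ ≤ δ) (hη : 0 < η) :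
    ApproxContinuousAt g (fun _ => a + 2 * δ + η) m := by
  intro V hV
  have hm : ‖g m - f m‖ < δ + η := by
    rw [norm_sub_rev]
    linarith [h.self_of_nhds]
  obtain ⟨V₁, h₁, V₂, h₂, h₁₂⟩ := hB.exists_nhds_norm_sub_lt hm
  filter_upwards [hf V₂ h₂, hB.eventually_exists_mem (inter_mem hV h₁), h]
    with m' ⟨y, hy, hyle⟩ ⟨z, hzV, hz₁⟩ hδ
  refine ⟨z, hzV, ?_⟩
  have hzy := h₁₂ m' z y hz₁ hy
  rw [norm_sub_rev] at hzy hδ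
  calc ‖g m' - z‖ = ‖(g m' - f m') + (f m' - y) + (y - z)‖ := by congr 1; abel
    _ ≤ ‖g m' - f m'‖ + ‖f m' - y‖ + ‖y - z‖ := norm_add₃_le
    _ ≤ a + 2 * δ + η := by linarith

theorem exists_isOpen_norm_sub_lt (hB : IsContinuousBanachBundle F) {m : M} (x : F m) {η : ℝ}
    (hη : 0 < η) :
    ∃ V : Set (Σ m, F m), IsOpen V ∧ ⟨m, x⟩ ∈ V ∧
      ∀ (m' : M) (a b : F m'), (⟨m', a⟩ : Σ m, F m) ∈ V → (⟨m', b⟩ : Σ m, F m) ∈ V →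
        ‖a - b‖ < η := by
  obtain ⟨V₁, h₁, V₂, h₂, h⟩ := hB.exists_nhds_norm_sub_lt (x := x) (y := x) (by simpa using hη)
  refine ⟨interior (V₁ ∩ V₂), isOpen_interior, mem_interior_iff_mem_nhds.2 (inter_mem h₁ h₂),
    fun m' a b ha hb => h m' a b (interior_subset ha).1 (interior_subset hb).2⟩

theorem approxContinuousAt_of_mem (hB : IsContinuousBanachBundle F) {V : Set (Σ m, F m)}
    (hV : IsOpen V) {η : ℝ}
    (hη : ∀ (m' : M) (a b : F m'), (⟨m', a⟩ : Σ m, F m) ∈ V → (⟨m', b⟩ : Σ m, F m) ∈ V →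
        ‖a - b‖ < η) {f : ∀ m, F m} {m : M} (hf : ∀ᶠ m' in 𝓝 m, ⟨m', f m'⟩ ∈ V) :
    ApproxContinuousAt f (fun _ => η) m := by
  intro W hW
  filter_upwards [hf, hB.eventually_exists_mem (inter_mem hW (hV.mem_nhds hf.self_of_nhds))]
    with m' hm' ⟨y, hyW, hyV⟩
  exact ⟨y, hyW, (hη m' _ _ hm' hyV).le⟩

theorem exists_approxContinuousAt_local (hB : IsContinuousBanachBundle F) {f : ∀ m, F m} {ε η : ℝ}
    {m : M} (hf : ApproxContinuousAt f (fun _ => ε) m) (hη : 0 < η) :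
    ∃ O : Set M, IsOpen O ∧ m ∈ O ∧ ∃ g : ∀ m, F m,
      ∀ m' ∈ O, ‖f m' - g m'‖ ≤ ε ∧ ApproxContinuousAt g (fun _ => η) m' := by
  classical
  obtain ⟨V, hVo, hmV, hV⟩ := hB.exists_isOpen_norm_sub_lt (f m) hη
  obtain ⟨O, hO, hOo, hmO⟩ := eventually_nhds_iff.1 (hf V (hVo.mem_nhds hmV))
  choose! g hg using hO
  refine ⟨O, hOo, hmO, g, fun m' hm' => ⟨(hg m' hm').2, ?_⟩⟩
  refine hB.approxContinuousAt_of_mem hVo hV ?_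
  filter_upwards [hOo.mem_nhds hm'] with x hx using (hg x hx).1

theorem exists_approxContinuousAt_of_isCompact [LocallyCompactSpace M] [T2Space M]
    (hB : IsContinuousBanachBundle F) {K : Set M} (hK : IsCompact K) {f : ∀ m, F m} {ε η : ℝ}
    (hf : ∀ m ∈ K, ApproxContinuousAt f (fun _ => ε) m) (hη : 0 < η) :
    ∃ g : ∀ m, F m, ∀ m ∈ K, ‖f m - g m‖ ≤ ε ∧ ApproxContinuousAt g (fun _ => η) m := by
  have hloc : ∀ m : M, ∃ O : Set M, m ∈ K → IsOpen O ∧ m ∈ O ∧ ∃ g : ∀ m, F m,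
      ∀ m' ∈ O, ‖f m' - g m'‖ ≤ ε ∧ ApproxContinuousAt g (fun _ => η / 2) m' := by
    intro m
    by_cases hm : m ∈ K
    · obtain ⟨O, hO⟩ := hB.exists_approxContinuousAt_local (hf m hm) (half_pos hη)
      exact ⟨O, fun _ => hO⟩
    · exact ⟨∅, fun h => absurd h hm⟩
  choose O hO using hloc
  obtain ⟨t, htK, ht⟩ := hK.elim_nhds_subcover O
    fun m hm => (hO m hm).1.mem_nhds (hO m hm).2.1
  let e := t.equivFin
  have he : ∀ i, ((e.symm i : t) : M) ∈ K := fun i => htK _ (e.symm i).2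
  choose g hg using fun i => (hO _ (he i)).2.2
  obtain ⟨ρ, hρs, hρ1, hρ01, -⟩ := exists_continuous_sum_one_of_isOpen_isCompact
    (s := fun i => O (e.symm i)) (fun i => (hO _ (he i)).1) hK (by
      intro m hm
      obtain ⟨x, hx, hmx⟩ := Set.mem_iUnion₂.1 (ht hm)
      exact Set.mem_iUnion.2 ⟨e ⟨x, hx⟩, by simpa using hmx⟩)
  refine ⟨∑ i, fun m => (ρ i m : ℂ) • g i m, fun m hm => ⟨?_, ?_⟩⟩
  · have h1 : ∑ i, ρ i m = 1 := by simpa using hρ1 hm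
    have h1' : ∑ i, (ρ i m : ℂ) = 1 := by exact_mod_cast h1
    have hsub : f m - (∑ i, fun m => (ρ i m : ℂ) • g i m : ∀ m, F m) m
        = ∑ i, (ρ i m : ℂ) • (f m - g i m) := by
      simp only [smul_sub, Finset.sum_sub_distrib, ← Finset.sum_smul, h1', one_smul,
        Finset.sum_apply]
    rw [hsub]
    calc ‖∑ i, (ρ i m : ℂ) • (f m - g i m)‖ ≤ ∑ i, ‖(ρ i m : ℂ) • (f m - g i m)‖ :=
          norm_sum_le _ _
      _ ≤ ∑ i, ρ i m * ε := by
          refine Finset.sum_le_sum fun i _ => ?_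
          have h0 := (hρ01 i m).1
          rw [norm_smul, Complex.norm_real, Real.norm_of_nonneg h0]
          by_cases hi : m ∈ tsupport (ρ i)
          · exact mul_le_mul_of_nonneg_left (hg i m (hρs i hi)).1 h0
          · simp [image_eq_zero_of_notMem_tsupport hi]
      _ = ε := by rw [← Finset.sum_mul, h1, one_mul]
  · have hac : ∀ i, ApproxContinuousAt (fun m => (ρ i m : ℂ) • g i m)
        (fun m => ρ i m * (η / 2)) m := by
      intro i
      by_cases hi : m ∈ tsupport (ρ i)
      · refine (hB.approxContinuousAt_smul (ρ := fun m => (ρ i m : ℂ)) (by fun_prop)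
          (hg i m (hρs i hi)).2).mono (.of_forall fun m' => ?_)
        rw [Complex.norm_real, Real.norm_of_nonneg (hρ01 i m').1]
      · have hev := notMem_tsupport_iff_eventuallyEq.1 hi
        refine ((hB.approxContinuousAt_zero m).congr ?_).mono (.of_forall fun m' => ?_)
        · filter_upwards [hev] with m' hm'
          simp [hm']
        · exact mul_nonneg (hρ01 i m').1 (by positivity)
    refine (hB.approxContinuousAt_sum Finset.univ fun i _ => hac i).mono ?_
    have hcont : ContinuousAt (fun m' => ∑ i, ρ i m') m := by fun_prop
    have h1 : ∑ i, ρ i m = 1 := by simpa using hρ1 hm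
    filter_upwards [hcont.eventually_lt (continuousAt_const (y := (2 : ℝ))) (by rw [h1]; norm_num)]
      with m' hm'
    rw [Finset.sum_apply, ← Finset.sum_mul]
    nlinarith

/-- Sections that are continuous up to a tolerance on a compact set are close to a section
that is continuous on its interior. -/
theorem exists_continuousAt_of_approxContinuousAt [LocallyCompactSpace M] [T2Space M]
    (hB : IsContinuousBanachBundle F) {K : Set M} (hK : IsCompact K) {f : ∀ m, F m} {ε : ℝ}
    (hε : 0 < ε) (hf : ∀ m ∈ K, ApproxContinuousAt f (fun _ => ε) m) :
    ∃ g : ∀ m, F m, (∀ m ∈ K, ‖f m - g m‖ ≤ 2 * ε) ∧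
      ∀ m ∈ interior K, ContinuousAt (fun m => (⟨m, g m⟩ : Σ m, F m)) m := by
  have step : ∀ (n : ℕ) (f : {f : ∀ m, F m //
      ∀ m ∈ K, ApproxContinuousAt f (fun _ => ε / 2 ^ n) m}),
      ∃ g : {f : ∀ m, F m // ∀ m ∈ K, ApproxContinuousAt f (fun _ => ε / 2 ^ (n + 1)) m},
        ∀ m ∈ K, ‖f.1 m - g.1 m‖ ≤ ε / 2 ^ n := by
    intro n f
    obtain ⟨g, hg⟩ := hB.exists_approxContinuousAt_of_isCompact hK f.2
      (η := ε / 2 ^ (n + 1)) (by positivity)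
    exact ⟨⟨g, fun m hm => (hg m hm).2⟩, fun m hm => (hg m hm).1⟩
  choose next hnext using step
  let u : ∀ n : ℕ, {f : ∀ m, F m // ∀ m ∈ K, ApproxContinuousAt f (fun _ => ε / 2 ^ n) m} :=
    fun n => Nat.rec ⟨f, by simpa using hf⟩ next n
  have hu : ∀ m ∈ K, ∀ n, dist ((u n).1 m) ((u (n + 1)).1 m) ≤ 2 * ε / 2 / 2 ^ n := by
    intro m hm n
    rw [dist_eq_norm, mul_div_cancel_left₀ _ two_ne_zero]
    exact hnext n (u n) m hm
  have hlim : ∀ m, ∃ l : F m, m ∈ K → Tendsto (fun n => (u n).1 m) atTop (𝓝 l) := by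
    intro m
    by_cases hm : m ∈ K
    · obtain ⟨l, hl⟩ := cauchySeq_tendsto_of_complete (cauchySeq_of_le_geometric_two (hu m hm))
      exact ⟨l, fun _ => hl⟩
    · exact ⟨0, fun h => absurd h hm⟩
  choose g hg using hlim
  have hug : ∀ n, ∀ m ∈ K, ‖(u n).1 m - g m‖ ≤ 2 * ε / 2 ^ n := fun n m hm => by
    rw [← dist_eq_norm]
    exact dist_le_of_le_geometric_two_of_tendsto (hu m hm) (hg m hm) n
  refine ⟨g, fun m hm => (hug 0 m hm).trans_eq (by simp), fun m hm => ?_⟩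
  refine hB.continuousAt_of_approxContinuousAt fun δ hδ => ?_
  obtain ⟨n, hn⟩ := exists_pow_lt_of_lt_one (y := (1 / 2 : ℝ)) (x := δ / (10 * ε))
    (by positivity) (by norm_num)
  have hnear : ∀ᶠ m' in 𝓝 m, ‖(u n).1 m' - g m'‖ ≤ 2 * ε / 2 ^ n := by
    filter_upwards [mem_interior_iff_mem_nhds.1 hm] with m' hm' using hug n m' hm'
  refine (hB.approxContinuousAt_of_norm_sub_le ((u n).2 m (interior_subset hm)) hnear
    (half_pos hδ)).mono (.of_forall fun _ => ?_)
  · have : ε / 2 ^ n < δ / 10 := by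
      rw [one_div, inv_pow, lt_div_iff₀ (by positivity)] at hn
      rw [div_eq_inv_mul]
      linarith
    have h2 : 2 * ε / 2 ^ n = 2 * (ε / 2 ^ n) := by ring
    rw [h2]
    linarith

theorem exists_section_norm_sub_le [LocallyCompactSpace M] [T2Space M]
    (hB : IsContinuousBanachBundle F) {m : M} (x : F m) {ε : ℝ} (hε : 0 < ε) :
    ∃ g : ∀ m, F m, ‖x - g m‖ ≤ ε ∧
      ∀ᶠ m' in 𝓝 m, ContinuousAt (fun m => (⟨m, g m⟩ : Σ m, F m)) m' := by
  obtain ⟨V, hVo, hxV, hV⟩ := hB.exists_isOpen_norm_sub_lt x (by positivity : 0 < ε / 3)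
  obtain ⟨O, hO, hOo, hmO⟩ :=
    eventually_nhds_iff.1 (hB.eventually_exists_mem (hVo.mem_nhds hxV))
  choose! f hf using hO
  obtain ⟨K, hK, hmK, hKO⟩ := exists_compact_subset hOo hmO
  obtain ⟨g, hfg, hg⟩ := hB.exists_continuousAt_of_approxContinuousAt hK
    (by positivity : 0 < ε / 3) (f := f) fun m' hm' =>
      hB.approxContinuousAt_of_mem hVo hV
        (by filter_upwards [hOo.mem_nhds (hKO hm')] with y hy using hf y hy)
  refine ⟨g, ?_, ?_⟩
  · have h1 := hV m x (f m) hxV (hf m hmO)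
    have h2 := hfg m (interior_subset hmK)
    linarith [norm_sub_le_norm_sub_add_norm_sub x (f m) (g m)]
  · filter_upwards [isOpen_interior.mem_nhds hmK] with m' hm' using hg m' hm'

theorem continuousAt_add (hB : IsContinuousBanachBundle F) {X : Type*} [TopologicalSpace X]
    {p : X → M} {f g : ∀ x, F (p x)} {x : X}
    (hf : ContinuousAt (fun x => (⟨p x, f x⟩ : Σ m, F m)) x)
    (hg : ContinuousAt (fun x => (⟨p x, g x⟩ : Σ m, F m)) x) :
    ContinuousAt (fun x => (⟨p x, f x + g x⟩ : Σ m, F m)) x := by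
  refine Filter.tendsto_def.2 fun W hW => ?_
  obtain ⟨V₁, h₁, V₂, h₂, h⟩ := hB.exists_nhds_add hW
  filter_upwards [hf h₁, hg h₂] with y h1 h2 using h _ _ _ h1 h2

theorem continuousAt_smul (hB : IsContinuousBanachBundle F) {X : Type*} [TopologicalSpace X]
    {p : X → M} {c : X → ℂ} {f : ∀ x, F (p x)} {x : X} (hc : ContinuousAt c x)
    (hf : ContinuousAt (fun x => (⟨p x, f x⟩ : Σ m, F m)) x) :
    ContinuousAt (fun x => (⟨p x, c x • f x⟩ : Σ m, F m)) x :=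
  ContinuousAt.comp (f := fun x => (c x, (⟨p x, f x⟩ : Σ m, F m)))
    hB.continuous_smul.continuousAt (hc.prodMk hf)

theorem continuousAt_sum (hB : IsContinuousBanachBundle F) {X : Type*} [TopologicalSpace X]
    {p : X → M} {x : X} (hp : ContinuousAt p x) {ι : Type*} (s : Finset ι)
    {f : ι → ∀ x, F (p x)}
    (hf : ∀ i ∈ s, ContinuousAt (fun x => (⟨p x, f i x⟩ : Σ m, F m)) x) :
    ContinuousAt (fun x => (⟨p x, ∑ i ∈ s, f i x⟩ : Σ m, F m)) x := by
  classical
  induction s using Finset.induction_on with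
  | empty =>
    simpa [Function.comp_def] using
      ContinuousAt.comp (f := p) hB.continuous_zero_section.continuousAt hp
  | insert i s hi ih =>
    simp only [Finset.sum_insert hi]
    exact hB.continuousAt_add (hf i (by simp)) (ih fun j hj => hf j (by simp [hj]))

/-- Every vector of a finite-dimensional fiber is the value of a section which is continuous
near the base point. -/
theorem exists_section_eq [LocallyCompactSpace M] [T2Space M]
    (hB : IsContinuousBanachBundle F) {m : M} [FiniteDimensional ℂ (F m)] (x : F m) :
    ∃ g : ∀ m, F m, g m = x ∧
      ∀ᶠ m' in 𝓝 m, ContinuousAt (fun m => (⟨m, g m⟩ : Σ m, F m)) m' := by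
  let S : Submodule ℂ (F m) :=
    { carrier := {x | ∃ g : ∀ m, F m, g m = x ∧
        ∀ᶠ m' in 𝓝 m, ContinuousAt (fun m => (⟨m, g m⟩ : Σ m, F m)) m'}
      zero_mem' := ⟨0, rfl, .of_forall fun _ => hB.continuous_zero_section.continuousAt⟩
      add_mem' := by
        rintro _ _ ⟨f, rfl, hf⟩ ⟨g, rfl, hg⟩
        exact ⟨f + g, rfl, by
          filter_upwards [hf, hg] with m' h1 h2 using hB.continuousAt_add (p := id) h1 h2⟩
      smul_mem' := by
        rintro c _ ⟨f, rfl, hf⟩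
        exact ⟨c • f, rfl, by
          filter_upwards [hf] with m' h1 using
            hB.continuousAt_smul (p := id) continuousAt_const h1⟩ }
  have hS : IsClosed (S : Set (F m)) := S.closed_of_finiteDimensional
  suffices x ∈ S from this
  rw [← SetLike.mem_coe, ← hS.closure_eq, Metric.mem_closure_iff]
  intro ε hε
  obtain ⟨g, hg, hgc⟩ := hB.exists_section_norm_sub_le x (half_pos hε)
  exact ⟨g m, ⟨g, rfl, hgc⟩, by rw [dist_eq_norm]; linarith⟩

theorem continuousAt_sectionCombination (hB : IsContinuousBanachBundle F) {d : ℕ}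
    {e : Fin d → ∀ m, F m} {m : M}
    (he : ∀ i, ContinuousAt (fun m => (⟨m, e i m⟩ : Σ m, F m)) m)
    (c : EuclideanSpace ℂ (Fin d)) :
    ContinuousAt (fun z : M × EuclideanSpace ℂ (Fin d) =>
      (⟨z.1, sectionCombination e z.1 z.2⟩ : Σ m, F m)) (m, c) := by
  simp only [sectionCombination_apply]
  refine hB.continuousAt_sum continuousAt_fst _ fun i _ => hB.continuousAt_smul (by fun_prop) ?_
  exact ContinuousAt.comp (f := Prod.fst) (x := (m, c)) (he i) continuousAt_fst

/-- Continuous sections that are linearly independent at `m` span fibers uniformly isomorphic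
to `ℂ^d` near `m`. -/
theorem exists_eventually_norm_sectionCombination_bounds (hB : IsContinuousBanachBundle F) {d : ℕ}
    {e : Fin d → ∀ m, F m} {m : M}
    (he : ∀ i, ContinuousAt (fun m => (⟨m, e i m⟩ : Σ m, F m)) m)
    (hinj : Function.Injective (sectionCombination e m)) :
    ∃ a b : ℝ, 0 < a ∧ 0 < b ∧ ∀ᶠ m' in 𝓝 m, ∀ c : EuclideanSpace ℂ (Fin d),
      a * ‖c‖ ≤ ‖sectionCombination e m' c‖ ∧ ‖sectionCombination e m' c‖ ≤ b * ‖c‖ := by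
  obtain ⟨K, hK, hanti⟩ := (sectionCombination e m).exists_antilipschitzWith
    (LinearMap.ker_eq_bot.2 hinj)
  let L := LinearMap.toContinuousLinearMap (sectionCombination e m)
  have hK' : (0 : ℝ) < K := hK
  have hlow : ∀ c ∈ Metric.sphere (0 : EuclideanSpace ℂ (Fin d)) 1,
      (K : ℝ)⁻¹ / 2 < ‖sectionCombination e m c‖ := by
    intro c hc
    have h := hanti.le_mul_dist c 0
    rw [map_zero, dist_zero_right, dist_zero_right, mem_sphere_zero_iff_norm.1 hc] at h
    have h' : (K : ℝ)⁻¹ ≤ ‖sectionCombination e m c‖ := by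
      rwa [inv_le_iff_one_le_mul₀' hK']
    linarith [inv_pos.2 hK']
  have hup : ∀ c ∈ Metric.sphere (0 : EuclideanSpace ℂ (Fin d)) 1,
      ‖sectionCombination e m c‖ < ‖L‖ + 1 := by
    intro c hc
    have h := L.le_opNorm c
    rw [mem_sphere_zero_iff_norm.1 hc, mul_one] at h
    exact lt_of_le_of_lt h (lt_add_one _)
  refine ⟨(K : ℝ)⁻¹ / 2, ‖L‖ + 1, by positivity, by positivity, ?_⟩
  have hev := (isCompact_sphere
    (0 : EuclideanSpace ℂ (Fin d)) 1).eventually_forall_of_forall_eventually (x₀ := m) (P := fun m' c => (K : ℝ)⁻¹ / 2 < ‖sectionCombination e m' c‖ ∧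
      ‖sectionCombination e m' c‖ < ‖L‖ + 1) fun c hc => by
    have hcont : ContinuousAt (fun z : M × EuclideanSpace ℂ (Fin d) =>
        ‖sectionCombination e z.1 z.2‖) (m, c) :=
      ContinuousAt.comp (f := fun z : M × EuclideanSpace ℂ (Fin d) =>
        (⟨z.1, sectionCombination e z.1 z.2⟩ : Σ m, F m)) hB.continuous_norm.continuousAt
        (hB.continuousAt_sectionCombination he c)
    exact (hcont.eventually (lt_mem_nhds (hlow c hc))).and
      (hcont.eventually (gt_mem_nhds (hup c hc)))
  filter_upwards [hev] with m' hm' c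
  rcases eq_or_ne c 0 with rfl | hc
  · simp
  have hc' : 0 < ‖c‖ := norm_pos_iff.2 hc
  have h := hm' ((‖c‖⁻¹ : ℂ) • c) (by simp [norm_smul, hc'.ne'])
  rw [map_smul, norm_smul, norm_inv, Complex.norm_real, norm_norm, ← div_eq_inv_mul,
    lt_div_iff₀ hc', div_lt_iff₀ hc'] at h
  exact ⟨h.1.le, h.2.le⟩

theorem isLocallyTrivial_of_finiteDimensional [LocallyCompactSpace M] [T2Space M]
    (hB : IsContinuousBanachBundle F) (hfin : ∀ m, FiniteDimensional ℂ (F m))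
    (hloc : IsLocallyConstant (fun m => Module.finrank ℂ (F m))) :
    IsLocallyTrivialBanachBundle F := by
  intro m₀
  let d := Module.finrank ℂ (F m₀)
  let B := Module.finBasis ℂ (F m₀)
  choose e heB he using fun i : Fin d => hB.exists_section_eq (B i)
  have hinj : Function.Injective (sectionCombination e m₀) := by
    refine LinearMap.ker_eq_bot.1 (LinearMap.ker_eq_bot'.2 fun c hc => ?_)
    rw [sectionCombination_apply] at hc
    simp only [heB] at hc
    ext i
    exact Fintype.linearIndependent_iff.1 B.linearIndependent _ hc i
  obtain ⟨a, b, ha, hb, hab⟩ := hB.exists_eventually_norm_sectionCombination_bounds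
    (fun i => (he i).self_of_nhds) hinj
  obtain ⟨C, hCm, hCsub, hC⟩ := local_compact_nhds
    ((eventually_all.2 he).and (hab.and (hloc.eventually_eq m₀)))
  have hbij : ∀ m ∈ C, Function.Bijective (sectionCombination e m) := by
    intro m hm
    have hi : Function.Injective (sectionCombination e m) := by
      refine LinearMap.ker_eq_bot.1 (LinearMap.ker_eq_bot'.2 fun c hc => ?_)
      have h := ((hCsub hm).2.1 c).1
      rw [hc, norm_zero] at h
      exact norm_le_zero_iff.1 (nonpos_of_mul_nonpos_right h ha)
    refine ⟨hi, (LinearMap.injective_iff_surjective_of_finrank_eq_finrank ?_).1 hi⟩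
    rw [finrank_euclideanSpace_fin]
    exact (hCsub hm).2.2.symm
  let L : ∀ m : C, EuclideanSpace ℂ (Fin d) ≃ₗ[ℂ] F m := fun m =>
    LinearEquiv.ofBijective (sectionCombination e m) (hbij m m.2)
  have hLb : ∀ (m : C) (c : EuclideanSpace ℂ (Fin d)), a * ‖c‖ ≤ ‖L m c‖ ∧ ‖L m c‖ ≤ b * ‖c‖ :=
    fun m => (hCsub m.2).2.1
  have hLc : ∀ (m : C) (c : EuclideanSpace ℂ (Fin d)),
      ContinuousAt (fun z : M × EuclideanSpace ℂ (Fin d) =>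
        (⟨z.1, sectionCombination e z.1 z.2⟩ : Σ m, F m)) (m, c) :=
    fun m => hB.continuousAt_sectionCombination (hCsub m.2).1
  let Φ : {v : Σ m, F m // v.1 ∈ C} ≃ₜ C × EuclideanSpace ℂ (Fin d) :=
    { toFun := fun v => (⟨v.1.1, v.2⟩, (L ⟨v.1.1, v.2⟩).symm v.1.2)
      invFun := fun z => ⟨⟨z.1, L z.1 z.2⟩, z.1.2⟩
      left_inv := fun v => by simp
      right_inv := fun z => by simp
      continuous_toFun := by
        refine Continuous.prodMk
          ((hB.continuous_proj.comp continuous_subtype_val).subtype_mk _) ?_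
        refine continuous_iff_continuousAt.2 fun v => Metric.tendsto_nhds.2 fun ε hε => ?_
        obtain ⟨⟨m, x⟩, hm⟩ := v
        set c := (L ⟨m, hm⟩).symm x
        have hc : sectionCombination e m c = x := (L ⟨m, hm⟩).apply_symm_apply x
        obtain ⟨V₁, h₁, V₂, h₂, h⟩ := hB.exists_nhds_norm_sub_lt (m := m) (x := x)
          (y := sectionCombination e m c) (r := a * ε) (by rw [hc]; simpa using by positivity)
        have hsec : ContinuousAt (fun w : {v : Σ m, F m // v.1 ∈ C} =>
            (⟨w.1.1, sectionCombination e w.1.1 c⟩ : Σ m, F m)) ⟨⟨m, x⟩, hm⟩ :=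
          ContinuousAt.comp (f := fun w : {v : Σ m, F m // v.1 ∈ C} => (w.1.1, c))
            (x := ⟨⟨m, x⟩, hm⟩) (hLc ⟨m, hm⟩ c)
            ((hB.continuous_proj.comp continuous_subtype_val).prodMk
              continuous_const).continuousAt
        filter_upwards [hsec h₂, continuous_subtype_val.continuousAt h₁] with w hw₂ hw₁
        have hlt := h w.1.1 w.1.2 _ hw₁ hw₂
        have hle := (hLb ⟨w.1.1, w.2⟩ ((L ⟨w.1.1, w.2⟩).symm w.1.2 - c)).1
        rw [map_sub, LinearEquiv.apply_symm_apply] at hle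
        rw [dist_eq_norm]
        exact lt_of_mul_lt_mul_left (hle.trans_lt hlt) ha.le
      continuous_invFun := by
        refine Continuous.subtype_mk (continuous_iff_continuousAt.2 fun z => ?_) _
        exact ContinuousAt.comp (f := fun z : C × EuclideanSpace ℂ (Fin d) => ((z.1 : M), z.2))
          (hLc z.1 z.2) (by fun_prop) }
  refine ⟨C, hC, hCm, d, Φ, fun _ => rfl, fun m hm => map_add (L ⟨m, hm⟩).symm,
    fun m hm => map_smul (L ⟨m, hm⟩).symm, b⁻¹, a⁻¹, inv_pos.2 hb, inv_pos.2 ha, fun v => ?_⟩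
  have h := hLb ⟨v.1.1, v.2⟩ (Φ v).2
  have hv : L ⟨v.1.1, v.2⟩ (Φ v).2 = v.1.2 := LinearEquiv.apply_symm_apply _ _
  rw [hv] at h
  exact ⟨(inv_mul_le_iff₀ hb).2 h.2, (le_inv_mul_iff₀ ha).2 h.1⟩

end

end IsContinuousBanachBundle

theorem IsLocallyTrivialBanachBundle.exists_eventually_linearEquiv {F : M → Type v}
    [∀ m, NormedAddCommGroup (F m)] [∀ m, NormedSpace ℂ (F m)] [TopologicalSpace (Σ m, F m)]
    (h : IsLocallyTrivialBanachBundle F) (m₀ : M) :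
    ∃ d : ℕ, ∀ᶠ m in 𝓝 m₀, Nonempty (F m ≃ₗ[ℂ] EuclideanSpace ℂ (Fin d)) := by
  obtain ⟨C, -, hCm, d, Φ, hΦ, hadd, hsmul, -⟩ := h m₀
  refine ⟨d, ?_⟩
  filter_upwards [hCm] with m hm
  let T : F m →ₗ[ℂ] EuclideanSpace ℂ (Fin d) :=
    { toFun := fun x => (Φ ⟨⟨m, x⟩, hm⟩).2
      map_add' := hadd m hm
      map_smul' := hsmul m hm }
  refine ⟨LinearEquiv.ofBijective T ⟨fun x y hxy => ?_, fun c => ?_⟩⟩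
  · have hΦxy : Φ ⟨⟨m, x⟩, hm⟩ = Φ ⟨⟨m, y⟩, hm⟩ :=
      Prod.ext (Subtype.ext ((hΦ ⟨⟨m, x⟩, hm⟩).trans (hΦ ⟨⟨m, y⟩, hm⟩).symm)) hxy
    simpa using Φ.injective hΦxy
  · obtain ⟨⟨⟨m', x⟩, hm'⟩, hx⟩ := Φ.surjective (⟨m, hm⟩, c)
    obtain rfl : m = m' := by
      have := hΦ ⟨⟨m', x⟩, hm'⟩
      rwa [hx] at this
    exact ⟨x, congrArg Prod.snd hx⟩

/-- A continuous Banach bundle over a locally compact Hausdorff space is locally trivial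
if and only if all fibers are finite-dimensional and the dimension function is locally
constant. -/
theorem isLocallyTrivial_iff_finiteDimensional_and_locallyConstant_dim
    [LocallyCompactSpace M] [T2Space M]
    {F : M → Type v} [∀ m, NormedAddCommGroup (F m)] [∀ m, NormedSpace ℂ (F m)]
    [∀ m, CompleteSpace (F m)] [TopologicalSpace (Σ m, F m)]
    (hB : IsContinuousBanachBundle F) :
    IsLocallyTrivialBanachBundle F ↔
      (∀ m, FiniteDimensional ℂ (F m)) ∧
        IsLocallyConstant (fun m => Module.finrank ℂ (F m)) := by
  refine ⟨fun h => ⟨fun m => ?_, (IsLocallyConstant.iff_eventually_eq _).2 fun m => ?_⟩,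
    fun h => hB.isLocallyTrivial_of_finiteDimensional h.1 h.2⟩
  · obtain ⟨d, hd⟩ := h.exists_eventually_linearEquiv m
    obtain ⟨T⟩ := hd.self_of_nhds
    exact T.symm.finiteDimensional
  · obtain ⟨d, hd⟩ := h.exists_eventually_linearEquiv m
    obtain ⟨T⟩ := hd.self_of_nhds
    filter_upwards [hd] with m' ⟨T'⟩
    rw [T.finrank_eq, T'.finrank_eq]
end

section
/- Every continuous surjection from a compact Hausdorff space onto a Stonean (extremally disconnected compact Hausdorff) space admits a continuous section. -/
/-- **Gleason's theorem.** Every continuous surjection from a compact Hausdorff space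
onto a Stonean (extremally disconnected compact Hausdorff) space admits a continuous
section. -/
theorem gleason_continuous_section
    {K L : Type*} [TopologicalSpace K] [CompactSpace K] [T2Space K]
    [TopologicalSpace L] [CompactSpace L] [T2Space L] [ExtremallyDisconnected L]
    (q : K → L) (hq_cont : Continuous q) (hq_surj : Function.Surjective q) :
    ∃ σ : L → K, Continuous σ ∧ q ∘ σ = id := by
  have : ExtremallyDisconnected (ULift.{max u_1 u_2} L) :=
    extremallyDisconnected_of_homeo Homeomorph.ulift.symm
  obtain ⟨h, h_cont, hh⟩ := CompactT2.ExtremallyDisconnected.projective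
    (A := ULift.{max u_1 u_2} L) (f := id) (g := ULift.map.{_, _, max u_1 u_2, max u_1 u_2} q)
    continuous_id (continuous_uliftUp.comp (hq_cont.comp continuous_uliftDown))
    (ULift.map_surjective.mpr hq_surj)
  refine ⟨fun l => (h ⟨l⟩).down,
    continuous_uliftDown.comp (h_cont.comp continuous_uliftUp), ?_⟩
  funext l
  exact congrArg ULift.down (congrFun hh ⟨l⟩)
end
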